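/- Let ι : X → Y be a dense quasi-embedding of topological spaces and D a bc-domain with its Scott topology. For every f ∈ [X → D], we have f = f_* ∘ ι, where f_*(y) = ⊔{ ⊓ f(ι⁻¹(U)) : y ∈ U, U open in Y }. In particular (f_*)^* = f, where g^* denotes g ∘ ι. -/

import Mathlib

open Set TopologicalSpace

/-- The way-below relation: `x ≪ y` iff for every (nonempty) directed set `A`
whose supremum exists and satisfies `y ≤ ⊔ A`, some `d ∈ A` satisfies `x ≤ d`. -/
def WayBelow {α : Type*} [Preorder α] (x y : α) : Prop :=
  ∀ A : Set α, A.Nonempty → DirectedOn (· ≤ ·) A → ∀ a : α, IsLUB A a → y ≤ a → ∃ d ∈ A, x ≤ d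

/-- A bc-domain: a pointed, directed-complete, continuous, bounded-complete poset. -/
def IsBCDomain (D : Type*) [PartialOrder D] : Prop :=
  (∃ b : D, ∀ x : D, b ≤ x) ∧
  (∀ A : Set D, A.Nonempty → DirectedOn (· ≤ ·) A → ∃ a : D, IsLUB A a) ∧
  (∀ x : D, {a : D | WayBelow a x}.Nonempty ∧ DirectedOn (· ≤ ·) {a : D | WayBelow a x} ∧
    IsLUB {a : D | WayBelow a x} x) ∧
  (∀ A : Set D, BddAbove A → ∃ a : D, IsLUB A a)

/-- Scott-open subsets of a poset. -/
def IsScottOpen {D : Type*} [Preorder D] (O : Set D) : Prop :=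
  (∀ ⦃x⦄, x ∈ O → ∀ ⦃y⦄, x ≤ y → y ∈ O) ∧
  (∀ A : Set D, A.Nonempty → DirectedOn (· ≤ ·) A → ∀ a : D, IsLUB A a → a ∈ O →
    (A ∩ O).Nonempty)

/-- The Scott topology on a poset. -/
def scottTopology (D : Type*) [Preorder D] : TopologicalSpace D where
  IsOpen := IsScottOpen
  isOpen_univ := ⟨fun _ _ _ _ => trivial, fun A hA _ _ _ _ => by simpa using hA⟩
  isOpen_inter := by
    rintro O₁ O₂ ⟨hu₁, hd₁⟩ ⟨hu₂, hd₂⟩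
    refine ⟨fun x hx y hxy => ⟨hu₁ hx.1 hxy, hu₂ hx.2 hxy⟩, ?_⟩
    rintro A hA hdir a ha ⟨h1, h2⟩
    obtain ⟨x₁, hx₁A, hx₁⟩ := hd₁ A hA hdir a ha h1
    obtain ⟨x₂, hx₂A, hx₂⟩ := hd₂ A hA hdir a ha h2
    obtain ⟨z, hzA, hz₁, hz₂⟩ := hdir x₁ hx₁A x₂ hx₂A
    exact ⟨z, hzA, hu₁ hx₁ hz₁, hu₂ hx₂ hz₂⟩
  isOpen_sUnion := by
    intro 𝒮 h𝒮
    refine ⟨?_, ?_⟩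
    · rintro x ⟨O, hO, hxO⟩ y hxy
      exact ⟨O, hO, (h𝒮 O hO).1 hxO hxy⟩
    · rintro A hA hdir a ha ⟨O, hO, haO⟩
      obtain ⟨z, hzA, hzO⟩ := (h𝒮 O hO).2 A hA hdir a ha haO
      exact ⟨z, hzA, O, hO, hzO⟩

/-- The space `[X → D]` of continuous maps from a topological space `X` to a poset `D`
carrying its Scott topology, ordered pointwise (via the subtype order). -/
abbrev CMap (X : Type*) [TopologicalSpace X] (D : Type*) [Preorder D] : Type _ :=
  {f : X → D // @Continuous X D _ (scottTopology D) f}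

/-- The set `{ ⊓ f(ι⁻¹(U)) : y ∈ U, U open in Y }` of infima used to define `f_*`. -/
def starSet {X Y D : Type*} [TopologicalSpace Y] [Preorder D]
    (ι : X → Y) (f : X → D) (y : Y) : Set D :=
  {d : D | ∃ U : Set Y, IsOpen U ∧ y ∈ U ∧ IsGLB (f '' (ι ⁻¹' U)) d}

/-- A complete lattice is continuous if every element is the directed supremum of the
elements way-below it. -/
def IsContinuousLattice (L : Type*) [CompleteLattice L] : Prop :=
  ∀ x : L, {a : L | WayBelow a x}.Nonempty ∧ DirectedOn (· ≤ ·) {a : L | WayBelow a x} ∧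
    IsLUB {a : L | WayBelow a x} x

/-- A complete lattice is algebraic if every element is the directed supremum of the
finite (compact) elements below it. -/
def IsAlgebraicLattice (L : Type*) [CompleteLattice L] : Prop :=
  ∀ x : L, {a : L | WayBelow a a ∧ a ≤ x}.Nonempty ∧
    DirectedOn (· ≤ ·) {a : L | WayBelow a a ∧ a ≤ x} ∧
    IsLUB {a : L | WayBelow a a ∧ a ≤ x} x

/-- `B` is a (domain-theoretic) basis for the poset `D`: for every `x`, the set of
elements of `B` way-below `x` is directed with supremum `x`. -/
def IsBasisFor {D : Type*} [Preorder D] (B : Set D) : Prop :=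
  ∀ x : D, {b : D | b ∈ B ∧ WayBelow b x}.Nonempty ∧
    DirectedOn (· ≤ ·) {b : D | b ∈ B ∧ WayBelow b x} ∧
    IsLUB {b : D | b ∈ B ∧ WayBelow b x} x

/-- A space is strongly locally compact if its topology has a base of compact-open sets. -/
def StronglyLocallyCompact (Y : Type*) [TopologicalSpace Y] : Prop :=
  ∀ U : Set Y, IsOpen U → ∀ x ∈ U, ∃ Q : Set Y, IsCompact Q ∧ IsOpen Q ∧ x ∈ Q ∧ Q ⊆ U

open Classical in
/-- The single-step function `b·χ_O`. -/
noncomputable def stepFn {Y D : Type*} [Preorder D] [OrderBot D] (b : D) (O : Set Y) : Y → D :=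
  fun y => if y ∈ O then b else ⊥

theorem WayBelow.mono_aux {D : Type*} [Preorder D] {a b c d : D} (h1 : a ≤ b) (h : WayBelow b c)
    (h2 : c ≤ d) : WayBelow a d := by
  intro A hA hdir s hs hds
  obtain ⟨e, he, hbe⟩ := h A hA hdir s hs (h2.trans hds)
  exact ⟨e, he, h1.trans hbe⟩

theorem wayBelow_interp {D : Type*} [PartialOrder D] (hD : IsBCDomain D) {a x : D}
    (h : WayBelow a x) : ∃ b, WayBelow a b ∧ WayBelow b x := by
  obtain ⟨-, -, hc, -⟩ := hD
  have key : ∃ d ∈ {c : D | ∃ b, WayBelow c b ∧ WayBelow b x}, a ≤ d := by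
    refine h _ ?_ ?_ x ⟨?_, ?_⟩ le_rfl
    · obtain ⟨b, hb⟩ := (hc x).1
      obtain ⟨c, hc'⟩ := (hc b).1
      exact ⟨c, b, hc', hb⟩
    · rintro c1 ⟨b1, h1, h1'⟩ c2 ⟨b2, h2, h2'⟩
      obtain ⟨b, hb, hb1, hb2⟩ := (hc x).2.1 b1 h1' b2 h2'
      obtain ⟨c, hcb, hc1, hc2⟩ := (hc b).2.1 c1 (h1.mono_aux le_rfl hb1) c2
        (h2.mono_aux le_rfl hb2)
      exact ⟨c, ⟨b, hcb, hb⟩, hc1, hc2⟩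
    · rintro c ⟨b, hcb, hbx⟩
      exact ((hc b).2.2.1 hcb).trans ((hc x).2.2.1 hbx)
    · intro u hu
      refine (hc x).2.2.2 fun b hb => (hc b).2.2.2 fun c hcb => hu ⟨b, hcb, hb⟩
  obtain ⟨d, ⟨b, hdb, hbx⟩, had⟩ := key
  exact ⟨b, hdb.mono_aux had le_rfl, hbx⟩

theorem isScottOpen_wayBelow {D : Type*} [PartialOrder D] (hD : IsBCDomain D) (a : D) :
    IsScottOpen {d : D | WayBelow a d} := by
  refine ⟨fun x hx y hxy => WayBelow.mono_aux le_rfl hx hxy, ?_⟩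
  intro A hA hdir s hs has
  obtain ⟨b, hab, hbs⟩ := wayBelow_interp hD has
  obtain ⟨d, hd, hbd⟩ := hbs A hA hdir s hs le_rfl
  exact ⟨d, hd, hab.mono_aux le_rfl hbd⟩

/-- For a dense quasi-embedding `ι : X → Y` and a bc-domain `D`, every
continuous `f : X → D` satisfies `f = f_* ∘ ι`, where
`f_*(y) = ⊔{ ⊓ f(ι⁻¹(U)) : y ∈ U open }`; in particular `(f_*)^* = f`. -/
theorem fstar_restricts_to_f
    {X Y D : Type*} [TopologicalSpace X] [TopologicalSpace Y] [PartialOrder D]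
    (hD : IsBCDomain D)
    (ι : X → Y) (hcont : Continuous ι)
    (hro : ∀ U : Set X, IsOpen U → ∃ V : Set Y, IsOpen V ∧ U = ι ⁻¹' V)
    (hdense : Dense (Set.range ι))
    (f : X → D) (hf : @Continuous X D _ (scottTopology D) f)
    (g : Y → D) (hg : ∀ y : Y, IsLUB (starSet ι f y) (g y)) :
    f = fun x : X => g (ι x) := by
  funext x
  apply le_antisymm
  · refine (hD.2.2.1 (f x)).2.2.2 fun a ha => ?_
    have hopen : IsOpen (f ⁻¹' {d : D | WayBelow a d}) :=
      (@continuous_def X D _ (scottTopology D) f).1 hf _ (isScottOpen_wayBelow hD a)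
    obtain ⟨V, hV, hVe⟩ := hro _ hopen
    have hx : x ∈ ι ⁻¹' V := hVe ▸ ha
    have hlb : a ∈ lowerBounds (f '' (ι ⁻¹' V)) := by
      rintro _ ⟨z, hz, rfl⟩
      rw [← hVe] at hz
      exact (hD.2.2.1 (f z)).2.2.1 hz
    obtain ⟨m, hm⟩ := hD.2.2.2 (lowerBounds (f '' (ι ⁻¹' V)))
      ⟨f x, fun c hc => hc ⟨x, hx, rfl⟩⟩
    exact (hm.1 hlb).trans ((hg (ι x)).1 ⟨V, hV, hx, isLUB_lowerBounds.1 hm⟩)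
  · refine (hg (ι x)).2 ?_
    rintro d ⟨U, -, hxU, hd⟩
    exact hd.1 ⟨x, hxU, rfl⟩
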